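/- arXiv:1805.09165 — 2 statements merged into one kernel-verified Lean document; each statement's English description precedes it below -/
import Mathlib

section
/- (Iterative separator update.) Let X' = {P_1,…,P_{N-1}} ⊂ k^n be distinct points with a family of separators {Q_1,…,Q_{N-1}}, and let P_N ∈ k^n be a new point, P_N ∉ X'. For i < N let c_{i,N} be the minimal index h with a_{h,i} ≠ a_{h,N}, and set Q_i' = Q_i · (x_{c_{i,N}} − a_{c_{i,N},N})/(a_{c_{i,N},i} − a_{c_{i,N},N}); set Q_N' = Π_{(h,b) ∈ S_N} (x_h − b)/(a_{h,N} − b), where S_N = {(c_{N,j}, a_{c_{N,j},j}) : j < N} is the set of distinct such pairs. Then {Q_1',…,Q_N'} is a family of separators for X = X' ∪ {P_N}. -/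
open MvPolynomial

/-- **Iterative separator update.** Let `P_1, …, P_N` be distinct points with
separators `Q_1, …, Q_N`, and let `p` be a new point (distinct from all the `P_i`).  Let
`c i` be the minimal index where `P_i` and `p` differ.  Setting
`Q_i' = Q_i · (x_{c_i} − p_{c_i})/(P_i(c_i) − p_{c_i})` for old indices and
`Q' = Π_{(h,b) ∈ S} (x_h − b)/(p_h − b)` for the new point, where `S` is the set of distinct
pairs `(c_j, P_j(c_j))`, one obtains a family of separators for the enlarged set. -/
theorem statement12 {k : Type*} [Field k] [DecidableEq k] {n N : ℕ}
    (P : Fin N → (Fin n → k)) (hP : Function.Injective P)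
    (p : Fin n → k) (hp : ∀ i : Fin N, P i ≠ p)
    (Q : Fin N → MvPolynomial (Fin n) k)
    (hQ : ∀ i j : Fin N, eval (P j) (Q i) = if i = j then 1 else 0)
    (c : Fin N → Fin n)
    (hc : ∀ i : Fin N, P i (c i) ≠ p (c i) ∧ ∀ h : Fin n, h < c i → P i h = p h) :
    (∀ i j : Fin N,
      eval (P j) (Q i * (C ((P i (c i) - p (c i))⁻¹) * (X (c i) - C (p (c i))))) =
        if i = j then 1 else 0) ∧
    (∀ i : Fin N,
      eval p (Q i * (C ((P i (c i) - p (c i))⁻¹) * (X (c i) - C (p (c i))))) = 0) ∧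
    eval p (∏ q ∈ (Finset.univ.image fun j : Fin N => (c j, P j (c j))),
      (C ((p q.1 - q.2)⁻¹) * (X q.1 - C q.2))) = 1 ∧
    (∀ j : Fin N,
      eval (P j) (∏ q ∈ (Finset.univ.image fun j : Fin N => (c j, P j (c j))),
        (C ((p q.1 - q.2)⁻¹) * (X q.1 - C q.2))) = 0) := by
  refine ⟨fun i j => ?_, fun i => by simp, ?_, fun j => ?_⟩
  · rw [map_mul, hQ]
    split_ifs with hij
    · subst hij
      simp [inv_mul_cancel₀ (sub_ne_zero.mpr (hc i).1)]
    · rw [zero_mul]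
  · rw [map_prod]
    refine Finset.prod_eq_one fun q hq => ?_
    obtain ⟨j, -, rfl⟩ := Finset.mem_image.mp hq
    simp [inv_mul_cancel₀ (sub_ne_zero.mpr (hc j).1.symm)]
  · rw [map_prod]
    exact Finset.prod_eq_zero (Finset.mem_image_of_mem _ (Finset.mem_univ j)) (by simp)
end

section
/- (Möller's triangular set.) Let [P_1,…,P_N] be an ordered list of N distinct points of k^n. Then there exists a family of polynomials {q_1,…,q_N} ⊂ P that is triangular with respect to the ordering, i.e., q_i(P_i) = 1 for every i and q_i(P_j) = 0 whenever i < j. -/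
open MvPolynomial

theorem MvPolynomial.exists_eval_eq_one_and_eval_eq_zero {σ k : Type*} [Field k] {a b : σ → k}
    (hab : a ≠ b) : ∃ f : MvPolynomial σ k, eval a f = 1 ∧ eval b f = 0 := by
  obtain ⟨s, hs⟩ := Function.ne_iff.mp hab
  refine ⟨C (a s - b s)⁻¹ * (X s - C (b s)), ?_, ?_⟩
  · simp [inv_mul_cancel₀ (sub_ne_zero.mpr hs)]
  · simp

/-- **Möller's triangular set.** For every ordered list `[P_1, …, P_N]` of
distinct points of `k^n` there is a triangular family `{q_1, …, q_N}` of polynomials: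
`q_i(P_i) = 1` for all `i`, and `q_i(P_j) = 0` whenever `i < j`. -/
theorem statement13 {k : Type*} [Field k] {n N : ℕ}
    (P : Fin N → (Fin n → k)) (hP : Function.Injective P) :
    ∃ q : Fin N → MvPolynomial (Fin n) k,
      (∀ i : Fin N, eval (P i) (q i) = 1) ∧
      (∀ i j : Fin N, i < j → eval (P j) (q i) = 0) := by
  have h_sep (i j : Fin N) (hij : i < j) :
      ∃ f : MvPolynomial (Fin n) k, eval (P i) f = 1 ∧ eval (P j) f = 0 :=
    exists_eval_eq_one_and_eval_eq_zero (hP.ne hij.ne)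
  choose! f hf_one hf_zero using h_sep
  refine ⟨fun i => ∏ j ∈ Finset.Ioi i, f i j, fun i => ?_, fun i j hij => ?_⟩
  · rw [map_prod]
    exact Finset.prod_eq_one fun j hj => hf_one i j (Finset.mem_Ioi.mp hj)
  · rw [map_prod]
    exact Finset.prod_eq_zero (Finset.mem_Ioi.mpr hij) (hf_zero i j hij)
end
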